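/- For any strictly positive joint distribution p on C × K and any strictly positive conditional distribution q from C to K, if KL(p ‖ q̃) ≤ KL(p_C ⊗ p_K ‖ q̃) (where p_C ⊗ p_K is the product distribution (c,k) ↦ p_C(c)·p_K(k)), then I_θ(p,q) ≥ I(p). -/

import Mathlib

open Finset

/-- Marginal on the first coordinate: `p_C(c) = ∑ₖ p(c,k)`. -/
noncomputable def margC {C K : Type*} [Fintype K] (p : C × K → ℝ) (c : C) : ℝ :=
  ∑ k, p (c, k)

/-- Marginal on the second coordinate: `p_K(k) = ∑_c p(c,k)`. -/
noncomputable def margK {C K : Type*} [Fintype C] (p : C × K → ℝ) (k : K) : ℝ :=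
  ∑ c, p (c, k)

/-- Conditional distribution: `p(k|c) = p(c,k) / p_C(c)`. -/
noncomputable def condK {C K : Type*} [Fintype K] (p : C × K → ℝ) (c : C) (k : K) : ℝ :=
  p (c, k) / margC p c

/-- Mutual information `I(p) = ∑_{(c,k)} p(c,k) log (p(c,k) / (p_C(c) p_K(k)))`. -/
noncomputable def mutInfo {C K : Type*} [Fintype C] [Fintype K] (p : C × K → ℝ) : ℝ :=
  ∑ ck : C × K, p ck * Real.log (p ck / (margC p ck.1 * margK p ck.2))

/-- The plug-in estimator
`I_est(p) = ∑ p(c,k) log p(k|c) − ∑ p_C(c) p_K(k) log p(k|c)`. -/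
noncomputable def Iest {C K : Type*} [Fintype C] [Fintype K] (p : C × K → ℝ) : ℝ :=
  (∑ ck : C × K, p ck * Real.log (condK p ck.1 ck.2)) -
    ∑ ck : C × K, margC p ck.1 * margK p ck.2 * Real.log (condK p ck.1 ck.2)

/-- The variational estimator, for `q (c,k) = q(k|c)` a conditional distribution:
`I_θ(p,q) = ∑ p(c,k) log q(k|c) − ∑ p_C(c) p_K(k) log q(k|c)`. -/
noncomputable def Itheta {C K : Type*} [Fintype C] [Fintype K] (p q : C × K → ℝ) : ℝ :=
  (∑ ck : C × K, p ck * Real.log (q ck)) -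
    ∑ ck : C × K, margC p ck.1 * margK p ck.2 * Real.log (q ck)

/-- Kullback–Leibler divergence of finitely supported positive distributions. -/
noncomputable def KLdiv {A : Type*} [Fintype A] (r s : A → ℝ) : ℝ :=
  ∑ a, r a * Real.log (r a / s a)

theorem margC_pos {C K : Type*} [Fintype K] [Nonempty K] {p : C × K → ℝ}
    (hpos : ∀ ck, 0 < p ck) (c : C) : 0 < margC p c :=
  sum_pos (fun k _ => hpos (c, k)) univ_nonempty

theorem margK_pos {C K : Type*} [Fintype C] [Nonempty C] {p : C × K → ℝ}
    (hpos : ∀ ck, 0 < p ck) (k : K) : 0 < margK p k :=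
  sum_pos (fun c _ => hpos (c, k)) univ_nonempty

theorem sum_margC {C K : Type*} [Fintype C] [Fintype K] (p : C × K → ℝ) :
    ∑ c, margC p c = ∑ ck, p ck :=
  (Fintype.sum_prod_type p).symm

/-- A joint distribution and the product of its marginals give the same expectation to a
function of the second coordinate. -/
theorem sum_mul_snd_eq_sum_marg_mul_snd {C K : Type*} [Fintype C] [Fintype K] {p : C × K → ℝ}
    (hsum : ∑ ck, p ck = 1) (f : K → ℝ) :
    ∑ ck : C × K, p ck * f ck.2 = ∑ ck : C × K, margC p ck.1 * margK p ck.2 * f ck.2 := by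
  calc ∑ ck : C × K, p ck * f ck.2 = ∑ k, margK p k * f k := by
        simp only [Fintype.sum_prod_type_right, margK, sum_mul]
    _ = (∑ c, margC p c) * ∑ k, margK p k * f k := by rw [sum_margC, hsum, one_mul]
    _ = ∑ ck : C × K, margC p ck.1 * margK p ck.2 * f ck.2 := by
        simp only [Fintype.sum_prod_type, sum_mul_sum, mul_assoc]

/-- The error of the variational estimator is a difference of two divergences from the
variational joint. -/
theorem Itheta_sub_mutInfo {C K : Type*} [Fintype C] [Fintype K] [Nonempty C] [Nonempty K]
    {p q : C × K → ℝ} (hpos : ∀ ck, 0 < p ck) (hsum : ∑ ck, p ck = 1) (hqpos : ∀ ck, 0 < q ck) :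
    Itheta p q - mutInfo p =
      KLdiv (fun ck : C × K => margC p ck.1 * margK p ck.2)
          (fun ck : C × K => margC p ck.1 * q ck) -
        KLdiv p (fun ck : C × K => margC p ck.1 * q ck) := by
  have hmarg := sum_mul_snd_eq_sum_marg_mul_snd hsum fun k => Real.log (margK p k)
  rw [← sub_eq_zero, ← sum_sub_distrib] at hmarg
  rw [← sub_eq_zero, ← hmarg]
  simp only [Itheta, mutInfo, KLdiv, ← sum_sub_distrib]
  refine sum_congr rfl fun ck _ => ?_
  have hp := (hpos ck).ne'
  have hq := (hqpos ck).ne'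
  have hC := (margC_pos hpos ck.1).ne'
  have hK := (margK_pos hpos ck.2).ne'
  rw [Real.log_div hp (mul_ne_zero hC hK), Real.log_div hp (mul_ne_zero hC hq),
    Real.log_div (mul_ne_zero hC hK) (mul_ne_zero hC hq), Real.log_mul hC hK, Real.log_mul hC hq]
  ring

/-- **Proposition 1.3 (discrete form).** If `KL(p ‖ q̃) ≤ KL(p_C ⊗ p_K ‖ q̃)` then
the variational estimator upper bounds the mutual information: `I_θ(p,q) ≥ I(p)`. -/
theorem Itheta_ge_mutInfo {C K : Type*} [Fintype C] [Fintype K] [Nonempty C] [Nonempty K]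
    (p q : C × K → ℝ) (hpos : ∀ ck, 0 < p ck) (hsum : ∑ ck : C × K, p ck = 1)
    (hqpos : ∀ ck, 0 < q ck) (hqsum : ∀ c, ∑ k, q (c, k) = 1)
    (hKL : KLdiv p (fun ck : C × K => margC p ck.1 * q ck) ≤
      KLdiv (fun ck : C × K => margC p ck.1 * margK p ck.2)
        (fun ck : C × K => margC p ck.1 * q ck)) :
    Itheta p q ≥ mutInfo p := by
  linarith [Itheta_sub_mutInfo hpos hsum hqpos]
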